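/- arXiv:1803.10803 — 3 statements merged into one kernel-verified Lean document; each statement's English description precedes it below -/
import Mathlib

section
/- Suppose that h(w) ≤ h(w') + ⟨∇h(w'), w − w'⟩ + (1/2)‖w − w'‖²_Σ for all w, w' ∈ W. Then for all w, w', w'' ∈ W one has ⟨∇h(w) − ∇h(w'), w'' − w'⟩ ≥ −(1/4)‖w − w''‖²_Σ. -/
open scoped RealInnerProductSpace

/-- The first-order characterization of convexity: a convex function lies above its tangent
hyperplanes. -/
theorem ConvexOn.add_inner_le_of_hasGradientAt {E : Type*} [NormedAddCommGroup E]
    [InnerProductSpace ℝ E] [CompleteSpace E] {f : E → ℝ} {g x : E}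
    (hf : ConvexOn ℝ Set.univ f) (hg : HasGradientAt f g x) (y : E) :
    f x + ⟪g, y - x⟫ ≤ f y := by
  have hline : ConvexOn ℝ Set.univ (f ∘ AffineMap.lineMap (k := ℝ) x y) :=
    hf.comp_affineMap (AffineMap.lineMap x y)
  have hderiv : HasDerivAt (f ∘ AffineMap.lineMap (k := ℝ) x y) ⟪g, y - x⟫ 0 := by
    have hg' : HasFDerivAt f (InnerProductSpace.toDual ℝ E g)
        (AffineMap.lineMap x y (0 : ℝ)) := by
      simpa using hg.hasFDerivAt
    simpa using hg'.comp_hasDerivAt (0 : ℝ) AffineMap.hasDerivAt_lineMap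
  have hslope := hline.le_slope_of_hasDerivAt (Set.mem_univ 0) (Set.mem_univ 1) one_pos hderiv
  simp only [slope_def_field, Function.comp_apply, AffineMap.lineMap_apply_one,
    AffineMap.lineMap_apply_zero, sub_zero, div_one] at hslope
  linarith

/-- Let `W` be a finite-dimensional real Hilbert space, `h : W → ℝ` a
convex continuously differentiable function and `Sig` a self-adjoint positive semidefinite
operator on `W`.  Suppose that `h w ≤ h w' + ⟨∇h w', w - w'⟩ + (1/2)‖w - w'‖²_Σ` for all
`w, w'`.  Then for all `w, w', w''` one has
`⟨∇h w - ∇h w', w'' - w'⟩ ≥ -(1/4)‖w - w''‖²_Σ`. -/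
theorem stmt_0 {W : Type*} [NormedAddCommGroup W] [InnerProductSpace ℝ W]
    [FiniteDimensional ℝ W]
    (h : W → ℝ) (hconv : ConvexOn ℝ Set.univ h) (hdiff : ContDiff ℝ 1 h)
    (Sig : W →L[ℝ] W) (hsa : IsSelfAdjoint Sig) (hpsd : ∀ v : W, 0 ≤ ⟪Sig v, v⟫)
    (hmaj : ∀ w w' : W, h w ≤ h w' + ⟪gradient h w', w - w'⟫
      + (1 / 2) * ⟪Sig (w - w'), w - w'⟫) :
    ∀ w w' w'' : W,
      -(1 / 4) * ⟪Sig (w - w''), w - w''⟫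
        ≤ ⟪gradient h w - gradient h w', w'' - w'⟫ := by
  intro w w' w''
  have tangent (x y : W) : h x + ⟪gradient h x, y - x⟫ ≤ h y :=
    hconv.add_inner_le_of_hasGradientAt (hdiff.differentiable one_ne_zero x).hasGradientAt y
  have upper (x v : W) : h (x + v) ≤ h x + ⟪gradient h x, v⟫ + (1 / 2) * ⟪Sig v, v⟫ := by
    simpa using hmaj (x + v) x
  obtain ⟨v, rfl⟩ : ∃ v : W, w'' = w + (2 : ℝ) • v := ⟨(1 / 2 : ℝ) • (w'' - w), by module⟩
  have hv := upper w v
  have hv' := upper w' (-v)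
  have ht := tangent w' (w + v)
  have ht' := tangent w (w' + -v)
  have hquad : w - (w + (2 : ℝ) • v) = (-2 : ℝ) • v := by module
  rw [hquad]
  simp only [map_neg, map_smul, inner_neg_left, inner_neg_right, inner_add_right,
    inner_sub_left, inner_sub_right, real_inner_smul_left, real_inner_smul_right]
    at hv hv' ht ht' ⊢
  linarith
end

section
/- For any (x*,w*) ∈ X × W solving the KKT system of (P) and every k ≥ 0, writing x_e^k := x^k − x* and w_e^k := w^k − w*, one has ((1/(2τσ))‖x_e^{k+1}‖² + (1/2)‖w_e^{k+1}‖²_{Σ_h+S}) − ((1/(2τσ))‖x_e^k‖² + (1/2)‖w_e^k‖²_{Σ_h+S}) ≤ −( ((2−τ)σ/2)‖A*w_e^{k+1}‖² + (1/2)‖w^{k+1}−w^k‖²_{(1/2)Σ_h+S} − ⟨d^k, w_e^{k+1}⟩ ). -/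
open scoped RealInnerProductSpace
open Filter Topology ContinuousLinearMap

/-- The set of subgradients (in the sense of convex analysis) of an
extended-real-valued function on a real inner product space. -/
def ESubdiff {W : Type*} [NormedAddCommGroup W] [InnerProductSpace ℝ W]
    (φ : W → EReal) (w : W) : Set W :=
  {d | ∀ u : W, φ w + ((⟪d, u - w⟫ : ℝ) : EReal) ≤ φ u}

/-- Convexity of an extended-real-valued function. -/
def EConvex {W : Type*} [AddCommGroup W] [Module ℝ W] (φ : W → EReal) : Prop :=
  ∀ u v : W, ∀ a b : ℝ, 0 ≤ a → 0 ≤ b → a + b = 1 →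
    φ (a • u + b • v) ≤ (a : EReal) * φ u + (b : EReal) * φ v

section SubgradientInequalities

variable {W : Type*} [NormedAddCommGroup W] [InnerProductSpace ℝ W]

/-- A convex function that is differentiable at `v` lies above its tangent plane at `v`. -/
lemma ConvexOn.add_inner_gradient_le [CompleteSpace W] {h : W → ℝ}
    (hconv : ConvexOn ℝ Set.univ h) {v : W} (hdiff : DifferentiableAt ℝ h v) (u : W) :
    h v + ⟪gradient h v, u - v⟫ ≤ h u := by
  have hline : ConvexOn ℝ Set.univ (h ∘ AffineMap.lineMap (k := ℝ) v u) := by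
    simpa using hconv.comp_affineMap (AffineMap.lineMap (k := ℝ) v u)
  have hderiv : HasDerivAt (h ∘ AffineMap.lineMap (k := ℝ) v u) (fderiv ℝ h v (u - v)) 0 := by
    have hv : HasFDerivAt h (fderiv ℝ h v) (AffineMap.lineMap (k := ℝ) v u 0) := by
      simpa using hdiff.hasFDerivAt
    exact hv.comp_hasDerivAt 0 AffineMap.hasDerivAt_lineMap
  have hslope := hline.le_slope_of_hasDerivAt (Set.mem_univ 0) (Set.mem_univ 1) one_pos hderiv
  have hgrad : ⟪gradient h v, u - v⟫ = fderiv ℝ h v (u - v) := by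
    rw [← toDual_gradient, InnerProductSpace.toDual_apply_apply]
  simp only [slope_def_field, Function.comp_apply, AffineMap.lineMap_apply_one,
    AffineMap.lineMap_apply_zero, sub_zero, div_one] at hslope
  linarith

/-- Three-point monotonicity of the gradient of a convex function majorized by the quadratic
form of `T`. -/
lemma neg_quarter_le_inner_gradient_sub [CompleteSpace W] {h : W → ℝ}
    (hconv : ConvexOn ℝ Set.univ h) (hdiff : Differentiable ℝ h) (T : W →L[ℝ] W)
    (hmaj : ∀ u v : W, h u ≤ h v + ⟪gradient h v, u - v⟫ + (1 / 2) * ⟪T (u - v), u - v⟫)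
    (u v y : W) :
    -(1 / 4) * ⟪T (u - v), u - v⟫ ≤ ⟪gradient h v - gradient h y, u - y⟫ := by
  set z : W := (1 / 2 : ℝ) • (u - v) with hz
  have lower₁ := hconv.add_inner_gradient_le (hdiff y) (v + z)
  have upper₁ := hmaj (v + z) v
  have lower₂ := hconv.add_inner_gradient_le (hdiff v) (y - z)
  have upper₂ := hmaj (y - z) y
  have e₁ : v + z - v = z := by abel
  have e₂ : y - z - y = -z := by abel
  have e₃ : v + z - y = z + (v - y) := by abel
  have e₄ : y - z - v = -z - (v - y) := by abel
  have e₅ : u - y = (2 : ℝ) • z + (v - y) := by rw [hz, smul_smul]; norm_num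
  have e₆ : u - v = (2 : ℝ) • z := by rw [hz, smul_smul]; norm_num
  rw [e₁] at upper₁
  rw [e₂] at upper₂
  rw [e₃] at lower₁
  rw [e₄] at lower₂
  rw [e₅, e₆]
  simp only [map_neg, map_smul, inner_add_right, inner_sub_right, inner_neg_right, inner_neg_left,
    inner_sub_left, inner_smul_left, inner_smul_right, neg_neg, conj_trivial]
    at lower₁ lower₂ upper₁ upper₂ ⊢
  linarith

/-- A real number bounded by arbitrarily small positive multiples of a constant is nonpositive. -/
lemma nonpos_of_forall_le_mul {a b : ℝ} (hab : ∀ t : ℝ, 0 < t → t ≤ 1 → a ≤ t * b) : a ≤ 0 := by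
  have hlim : Tendsto (fun t : ℝ => t * b) (𝓝[>] 0) (𝓝 0) := by
    have hcont : Continuous fun t : ℝ => t * b := by fun_prop
    simpa using hcont.continuousWithinAt (s := Set.Ioi 0) (x := 0) |>.tendsto
  refine ge_of_tendsto hlim ?_
  filter_upwards [Ioc_mem_nhdsGT (zero_lt_one' ℝ)] with t ht
  exact hab t ht.1 ht.2

/-- A function with a subgradient at `w` that is finite somewhere is finite at `w`. -/
lemma ne_top_of_mem_ESubdiff {φ : W → EReal} {g w u : W} (hg : g ∈ ESubdiff φ w)
    (hu : φ u ≠ ⊤) : φ w ≠ ⊤ := by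
  intro hw
  have hle := hg u
  rw [hw, EReal.top_add_coe, top_le_iff] at hle
  exact hu hle

/-- The subgradient inequality in terms of real values. -/
lemma toReal_add_inner_le_of_mem_ESubdiff {φ : W → EReal} (hbot : ∀ v, φ v ≠ ⊥) {g w u : W}
    (hg : g ∈ ESubdiff φ w) (hu : φ u ≠ ⊤) :
    (φ w).toReal + ⟪g, u - w⟫ ≤ (φ u).toReal := by
  have hle := hg u
  rw [← EReal.coe_toReal (ne_top_of_mem_ESubdiff hg hu) (hbot w),
    ← EReal.coe_toReal hu (hbot u)] at hle
  exact_mod_cast hle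

/-- If `g` is a subgradient of `φ + q` at `w`, and `q` has slope `l` towards `u` up to a quadratic
error, then `φ` satisfies the corresponding linearized subgradient inequality at `u`. -/
lemma toReal_add_inner_le_of_mem_ESubdiff_add {φ : W → EReal} (hconv : EConvex φ)
    (hbot : ∀ v, φ v ≠ ⊥) {q : W → ℝ} {g w u : W}
    (hg : g ∈ ESubdiff (fun v => φ v + (q v : EReal)) w) (hw : φ w ≠ ⊤) (hu : φ u ≠ ⊤)
    {l b : ℝ} (hq : ∀ t : ℝ, q (w + t • (u - w)) ≤ q w + t * l + t ^ 2 * b) :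
    (φ w).toReal + ⟪g, u - w⟫ ≤ (φ u).toReal + l := by
  suffices hle : (φ w).toReal + ⟪g, u - w⟫ - ((φ u).toReal + l) ≤ 0 by linarith
  refine nonpos_of_forall_le_mul (b := b) fun t ht ht1 => ?_
  have hpt : (1 - t) • w + t • u = w + t • (u - w) := by module
  have hc := hconv w u (1 - t) t (by linarith) ht.le (by ring)
  have hs : φ w + (q w : EReal) + ((⟪g, w + t • (u - w) - w⟫ : ℝ) : EReal)
      ≤ ((1 - t : ℝ) : EReal) * φ w + (t : EReal) * φ u + (q (w + t • (u - w)) : EReal) :=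
    (hg (w + t • (u - w))).trans (add_le_add_left (hpt ▸ hc) _)
  rw [← EReal.coe_toReal hw (hbot w), ← EReal.coe_toReal hu (hbot u), add_sub_cancel_left,
    inner_smul_right] at hs
  have hr : (φ w).toReal + q w + t * ⟪g, u - w⟫
      ≤ (1 - t) * (φ w).toReal + t * (φ u).toReal + q (w + t • (u - w)) := by
    exact_mod_cast hs
  have hqt := hq t
  refine le_of_mul_le_mul_left ?_ ht
  nlinarith

end SubgradientInequalities

/-- For any `(x*, w*)` solving the KKT system of (P) and every `k ≥ 0`,
writing `x_e^k := x^k - x*` and `w_e^k := w^k - w*`, one has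
`((1/(2τσ))‖x_e^{k+1}‖² + (1/2)‖w_e^{k+1}‖²_{Σ_h+S})
  - ((1/(2τσ))‖x_e^k‖² + (1/2)‖w_e^k‖²_{Σ_h+S})
  ≤ -(((2-τ)σ/2)‖A*w_e^{k+1}‖² + (1/2)‖w^{k+1}-w^k‖²_{(1/2)Σ_h+S} - ⟨d^k, w_e^{k+1}⟩)`. -/
theorem stmt_3
    {X W : Type*} [NormedAddCommGroup X] [InnerProductSpace ℝ X] [FiniteDimensional ℝ X]
    [NormedAddCommGroup W] [InnerProductSpace ℝ W] [FiniteDimensional ℝ W]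
    -- `φ` is a closed proper convex function on `W`
    (φ : W → EReal) (hφconv : EConvex φ) (hφlsc : LowerSemicontinuous φ)
    (hφbot : ∀ v, φ v ≠ ⊥) (hφtop : ∃ v, φ v ≠ ⊤)
    -- `h` is a convex continuously differentiable function on `W`
    (h : W → ℝ) (hhconv : ConvexOn ℝ Set.univ h) (hhdiff : ContDiff ℝ 1 h)
    -- problem data, penalty parameter and step-length
    (A : X →L[ℝ] W) (c : X) (σ τ : ℝ) (hσ : 0 < σ) (hτ0 : 0 < τ) (hτ2 : τ < 2)
    -- the majorization operator `Σ_h` (here `Sig`), self-adjoint positive semidefinite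
    (Sig S : W →L[ℝ] W) (hSigsa : IsSelfAdjoint Sig) (hSigpsd : ∀ v : W, 0 ≤ ⟪Sig v, v⟫)
    (hmaj : ∀ u v : W, h u ≤ h v + ⟪gradient h v, u - v⟫
      + (1 / 2) * ⟪Sig (u - v), u - v⟫)
    -- the proximal operator `S`: self-adjoint, `S ⪰ -(1/2)Σ_h`,
    -- and `(1/2)Σ_h + σAA* + S ≻ 0`
    (hSsa : IsSelfAdjoint S)
    (hS1 : ∀ v : W, -(1 / 2) * ⟪Sig v, v⟫ ≤ ⟪S v, v⟫)
    (hS2 : ∀ v : W, v ≠ 0 →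
      0 < (1 / 2) * ⟪Sig v, v⟫ + σ * ‖A.adjoint v‖ ^ 2 + ⟪S v, v⟫)
    -- the KKT system has a solution
    (hKKT : ∃ (xs : X) (ws : W),
      -(gradient h ws) - A xs ∈ ESubdiff φ ws ∧ A.adjoint ws = c)
    -- the iPALM iterates: errors, primal and dual sequences
    (ε : ℕ → ℝ) (hε : ∀ k, 0 ≤ ε k) (hεsum : Summable ε)
    (x : ℕ → X) (w : ℕ → W) (d : ℕ → W)
    (hd : ∀ k, ‖d k‖ ≤ ε k)
    -- `d^k ∈ ∂_w L_σ(w^{k+1}; (x^k, w^k)) + S(w^{k+1} - w^k)`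
    (hsub : ∀ k : ℕ, d k - S (w (k + 1) - w k) ∈
      ESubdiff (fun v : W =>
        φ v + ((h (w k) + ⟪gradient h (w k), v - w k⟫
          + (1 / 2) * ⟪Sig (v - w k), v - w k⟫
          + ⟪A.adjoint v - c, x k⟫
          + (σ / 2) * ‖A.adjoint v - c‖ ^ 2 : ℝ) : EReal)) (w (k + 1)))
    -- `x^{k+1} = x^k + τσ(A* w^{k+1} - c)`
    (hx : ∀ k : ℕ, x (k + 1) = x k + (τ * σ) • (A.adjoint (w (k + 1)) - c))
    :
    ∀ (xs : X) (ws : W),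
      (-(gradient h ws) - A xs ∈ ESubdiff φ ws ∧ A.adjoint ws = c) →
      ∀ k : ℕ,
        ((1 / (2 * τ * σ)) * ‖x (k + 1) - xs‖ ^ 2
            + (1 / 2) * ⟪(Sig + S) (w (k + 1) - ws), w (k + 1) - ws⟫)
          - ((1 / (2 * τ * σ)) * ‖x k - xs‖ ^ 2
            + (1 / 2) * ⟪(Sig + S) (w k - ws), w k - ws⟫)
        ≤ -(((2 - τ) * σ / 2) * ‖A.adjoint (w (k + 1) - ws)‖ ^ 2
            + (1 / 2) * ⟪((1 / 2 : ℝ) • Sig + S) (w (k + 1) - w k), w (k + 1) - w k⟫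
            - ⟪d k, w (k + 1) - ws⟫) := by
  rintro xs ws ⟨hs, hc⟩ k
  obtain ⟨v₀, hv₀⟩ := hφtop
  have hws : φ ws ≠ ⊤ := ne_top_of_mem_ESubdiff hs hv₀
  have hw : φ (w (k + 1)) ≠ ⊤ := fun htop =>
    ne_top_of_mem_ESubdiff (hsub k) (EReal.add_ne_top hws (EReal.coe_ne_top _))
      (by simp only [htop, EReal.top_add_coe])
  have hgrad := neg_quarter_le_inner_gradient_sub hhconv (hhdiff.differentiable one_ne_zero)
    Sig hmaj (w (k + 1)) (w k) ws
  have hopt := toReal_add_inner_le_of_mem_ESubdiff hφbot hs hw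
  have hsym : ∀ T : W →L[ℝ] W, IsSelfAdjoint T → ∀ u v : W, ⟪T u, v⟫ = ⟪T v, u⟫ :=
    fun T hT u v => (hT.isSymmetric u v).trans (real_inner_comm _ _)
  obtain ⟨e, he⟩ : ∃ e, e = w (k + 1) - ws := ⟨_, rfl⟩
  obtain ⟨p, hp⟩ : ∃ p, p = w (k + 1) - w k := ⟨_, rfl⟩
  obtain ⟨a, ha⟩ : ∃ a, a = A.adjoint e := ⟨_, rfl⟩
  have hres : A.adjoint (w (k + 1)) - c = a := by rw [ha, he, map_sub, hc]
  have hiter := toReal_add_inner_le_of_mem_ESubdiff_add hφconv hφbot (hsub k) hw hws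
    (l := -(⟪gradient h (w k), e⟫ + ⟪Sig p, e⟫ + ⟪a, x k⟫ + σ * ‖a‖ ^ 2))
    (b := (1 / 2) * ⟪Sig e, e⟫ + (σ / 2) * ‖a‖ ^ 2) (by
      intro t
      have e₁ : w (k + 1) + t • (ws - w (k + 1)) - w k = p - t • e := by rw [hp, he]; module
      have e₂ : A.adjoint (w (k + 1) + t • (ws - w (k + 1))) - c = (1 - t) • a := by
        have : w (k + 1) + t • (ws - w (k + 1)) = w (k + 1) - t • e := by rw [he]; module
        rw [this, map_sub, map_smul, ← ha, sub_right_comm, hres]; module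
      rw [e₁, e₂, hres, ← hp, norm_smul, mul_pow, Real.norm_eq_abs, sq_abs]
      simp only [map_sub, map_smul, inner_sub_left, inner_sub_right, inner_smul_left,
        inner_smul_right, conj_trivial]
      rw [hsym Sig hSigsa e p]
      apply le_of_eq
      ring)
  have e₃ : w k - ws = e - p := by rw [he, hp]; abel
  have e₄ : x (k + 1) - xs = (x k - xs) + (τ * σ) • a := by rw [hx, hres]; abel
  have e₅ : ws - w (k + 1) = -e := by rw [he]; abel
  have hAe : ⟪A xs, e⟫ = ⟪a, xs⟫ := by
    rw [ha, ContinuousLinearMap.adjoint_inner_left, real_inner_comm]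
  have hdual : (1 / (2 * τ * σ)) * ‖x (k + 1) - xs‖ ^ 2 - (1 / (2 * τ * σ)) * ‖x k - xs‖ ^ 2
      = ⟪a, x k⟫ - ⟪a, xs⟫ + τ * σ / 2 * ‖a‖ ^ 2 := by
    rw [e₄, norm_add_sq_real, norm_smul, inner_smul_right, mul_pow, Real.norm_eq_abs, sq_abs,
      real_inner_comm, inner_sub_right]
    field_simp
    ring
  rw [e₅] at hiter
  rw [← he, ← hp] at hgrad
  rw [← he] at hopt
  rw [← hp] at hiter
  rw [e₃, ← he, ← hp, ← ha]
  simp only [map_sub, add_apply, smul_apply,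
    inner_add_left, inner_sub_left, inner_sub_right, inner_neg_left, inner_neg_right,
    inner_smul_left, conj_trivial, hAe, hsym Sig hSigsa e p, hsym S hSsa e p]
    at hiter hgrad hopt ⊢
  linarith
end

section
/- Let N be a self-adjoint linear operator on Y with block components N_{ij}: Y_j → Y_i, let N_d := diag(N_{11},…,N_{ss}) be its block-diagonal part and N_u its strict block upper-triangular part, so that N = N_d + N_u + N_u*. If each diagonal block N_{ii} is self-adjoint positive definite, then N + N_u N_d^{−1} N_u* = (N_d + N_u) N_d^{−1} (N_d + N_u*), and this operator is self-adjoint positive definite on Y. -/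
open scoped RealInnerProductSpace
open Filter Topology ContinuousLinearMap

noncomputable section

/-- The set of joint subgradients of an extended-real-valued function of two
variables, with respect to the natural inner product of the product space. -/
def ESubdiffPair {Y Z : Type*} [NormedAddCommGroup Y] [InnerProductSpace ℝ Y]
    [NormedAddCommGroup Z] [InnerProductSpace ℝ Z]
    (g : Y → Z → EReal) (w : Y) (zz : Z) : Set (Y × Z) :=
  {dd | ∀ (u : Y) (v : Z),
    g w zz + ((⟪dd.1, u - w⟫ + ⟪dd.2, v - zz⟫ : ℝ) : EReal) ≤ g u v}

variable {n : ℕ} (Yf : Fin n → Type*) [∀ i, NormedAddCommGroup (Yf i)]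
  [∀ i, InnerProductSpace ℝ (Yf i)] [∀ i, FiniteDimensional ℝ (Yf i)]

/-- The projection onto the `i`-th block of `Y = Y₁ × ⋯ × Y_s`. -/
def projL (i : Fin n) : PiLp 2 Yf →L[ℝ] Yf i :=
  LinearMap.toContinuousLinearMap
    ((LinearMap.proj i).comp (WithLp.linearEquiv 2 ℝ (∀ j, Yf j)).toLinearMap)

/-- The inclusion of the `i`-th block into `Y = Y₁ × ⋯ × Y_s`. -/
def singleL (i : Fin n) : Yf i →L[ℝ] PiLp 2 Yf :=
  LinearMap.toContinuousLinearMap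
    ((WithLp.linearEquiv 2 ℝ (∀ j, Yf j)).symm.toLinearMap.comp (LinearMap.single ℝ Yf i))

/-- The vector whose blocks before `i` come from `a` and whose blocks from `i`
onwards come from `b`. -/
def glue (a b : PiLp 2 Yf) (i : Fin n) : PiLp 2 Yf :=
  (WithLp.linearEquiv 2 ℝ (∀ j, Yf j)).symm
    (fun j => if (j : ℕ) < (i : ℕ) then (WithLp.linearEquiv 2 ℝ (∀ j, Yf j)) a j
      else (WithLp.linearEquiv 2 ℝ (∀ j, Yf j)) b j)

/-- Replace the `i`-th block of `v` by `t`. -/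
def updBlk (v : PiLp 2 Yf) (i : Fin n) (t : Yf i) : PiLp 2 Yf :=
  (WithLp.linearEquiv 2 ℝ (∀ j, Yf j)).symm
    (Function.update ((WithLp.linearEquiv 2 ℝ (∀ j, Yf j)) v) i t)

/-- Assemble a family of block vectors into an element of `Y = Y₁ × ⋯ × Y_s`. -/
def asVec (g : ∀ i, Yf i) : PiLp 2 Yf := (WithLp.linearEquiv 2 ℝ (∀ j, Yf j)).symm g

/-- The block-diagonal part of an operator on `Y = Y₁ × ⋯ × Y_s`. -/
def diagOf (M : PiLp 2 Yf →L[ℝ] PiLp 2 Yf) : PiLp 2 Yf →L[ℝ] PiLp 2 Yf :=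
  ∑ i : Fin n, (singleL Yf i) ∘L ((projL Yf i) ∘L M ∘L (singleL Yf i)) ∘L (projL Yf i)

/-- The strict block upper-triangular part of an operator on `Y = Y₁ × ⋯ × Y_s`. -/
def upperOf (M : PiLp 2 Yf →L[ℝ] PiLp 2 Yf) : PiLp 2 Yf →L[ℝ] PiLp 2 Yf :=
  ∑ i : Fin n, ∑ j : Fin n, if (i : ℕ) < (j : ℕ) then
    (singleL Yf i) ∘L ((projL Yf i) ∘L M ∘L (singleL Yf j)) ∘L (projL Yf j)
  else 0

/-- The block-diagonal operator `diag(D₁, …, D_s)` on `Y = Y₁ × ⋯ × Y_s`. -/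
def blockDiag (D : ∀ i, Yf i →L[ℝ] Yf i) : PiLp 2 Yf →L[ℝ] PiLp 2 Yf :=
  ∑ i : Fin n, (singleL Yf i) ∘L (D i) ∘L (projL Yf i)


/-- The majorized augmented Lagrangian function of problem (MP). -/
def Lmb {X Z : Type*} [NormedAddCommGroup X] [InnerProductSpace ℝ X] [FiniteDimensional ℝ X]
    [NormedAddCommGroup Z] [InnerProductSpace ℝ Z] [FiniteDimensional ℝ Z]
    (i0 : Fin n) (p : Yf i0 → EReal) (f : PiLp 2 Yf → ℝ)
    (Sig : PiLp 2 Yf →L[ℝ] PiLp 2 Yf)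
    (F : X →L[ℝ] PiLp 2 Yf) (G : X →L[ℝ] Z) (c : X) (b : Z) (σ : ℝ)
    (y : PiLp 2 Yf) (z : Z) (x : X) (y' : PiLp 2 Yf) : EReal :=
  p (projL Yf i0 y) +
    ((f y' + ⟪gradient f y', y - y'⟫ + (1 / 2) * ⟪Sig (y - y'), y - y'⟫
      - ⟪b, z⟫ + ⟪F.adjoint y + G.adjoint z - c, x⟫
      + (σ / 2) * ‖F.adjoint y + G.adjoint z - c‖ ^ 2 : ℝ) : EReal)

end

section BlockOperators

variable {n : ℕ} {Yf : Fin n → Type*} [∀ i, NormedAddCommGroup (Yf i)]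
  [∀ i, InnerProductSpace ℝ (Yf i)] [∀ i, FiniteDimensional ℝ (Yf i)]

theorem projL_apply (i : Fin n) (v : PiLp 2 Yf) : projL Yf i v = v i := rfl

theorem singleL_apply (i j : Fin n) (t : Yf i) : singleL Yf i t j = Pi.single i t j := rfl

theorem projL_singleL_self (i : Fin n) (t : Yf i) : projL Yf i (singleL Yf i t) = t := by
  rw [projL_apply, singleL_apply, Pi.single_eq_same]

theorem projL_singleL_of_ne {i j : Fin n} (h : j ≠ i) (t : Yf i) :
    projL Yf j (singleL Yf i t) = 0 := by
  rw [projL_apply, singleL_apply, Pi.single_eq_of_ne h]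

theorem sum_singleL_projL (v : PiLp 2 Yf) : ∑ i, singleL Yf i (projL Yf i v) = v := by
  ext k
  rw [← projL_apply, map_sum, Finset.sum_eq_single k, projL_singleL_self, projL_apply]
  · exact fun j _ hj => projL_singleL_of_ne hj.symm _
  · simp

theorem inner_singleL_left (i : Fin n) (t : Yf i) (v : PiLp 2 Yf) :
    ⟪singleL Yf i t, v⟫ = ⟪t, projL Yf i v⟫ := by
  rw [PiLp.inner_apply, Finset.sum_eq_single i]
  · rw [← projL_apply, projL_singleL_self, projL_apply]
  · intro j _ hj
    rw [← projL_apply, projL_singleL_of_ne hj, inner_zero_left]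
  · simp

theorem adjoint_singleL (i : Fin n) : adjoint (singleL Yf i) = projL Yf i := by
  symm
  rw [eq_adjoint_iff]
  intro v t
  rw [real_inner_comm, ← inner_singleL_left, real_inner_comm]

theorem adjoint_projL (i : Fin n) : adjoint (projL Yf i) = singleL Yf i := by
  rw [← adjoint_singleL, adjoint_adjoint]

theorem diagOf_apply (M : PiLp 2 Yf →L[ℝ] PiLp 2 Yf) (v : PiLp 2 Yf) :
    diagOf Yf M v
      = ∑ i, singleL Yf i (projL Yf i (M (singleL Yf i (projL Yf i v)))) := by
  simp [diagOf]

theorem adjoint_diagOf (M : PiLp 2 Yf →L[ℝ] PiLp 2 Yf) :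
    adjoint (diagOf Yf M) = diagOf Yf (adjoint M) := by
  simp only [diagOf, map_sum, adjoint_comp, adjoint_singleL, adjoint_projL,
    ContinuousLinearMap.comp_assoc]

theorem adjoint_upperOf (M : PiLp 2 Yf →L[ℝ] PiLp 2 Yf) :
    adjoint (upperOf Yf M) = ∑ i : Fin n, ∑ j : Fin n, if (j : ℕ) < (i : ℕ) then
      (singleL Yf i) ∘L ((projL Yf i) ∘L (adjoint M) ∘L (singleL Yf j)) ∘L (projL Yf j)
      else 0 := by
  rw [Finset.sum_comm]
  simp only [upperOf, map_sum, apply_ite adjoint, map_zero, adjoint_comp, adjoint_singleL,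
    adjoint_projL, ContinuousLinearMap.comp_assoc]

theorem diagOf_add_upperOf_add_adjoint {M : PiLp 2 Yf →L[ℝ] PiLp 2 Yf}
    (hM : IsSelfAdjoint M) :
    diagOf Yf M + upperOf Yf M + adjoint (upperOf Yf M) = M := by
  have hM' : adjoint M = M := hM
  have hsum : M = ∑ i, ∑ j,
      (singleL Yf i) ∘L ((projL Yf i) ∘L M ∘L (singleL Yf j)) ∘L (projL Yf j) := by
    ext1 v
    simp only [_root_.sum_apply, ContinuousLinearMap.comp_apply]
    simp only [← map_sum, sum_singleL_projL]
  have hdiag : diagOf Yf M = ∑ i : Fin n, ∑ j : Fin n, if i = j then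
      (singleL Yf i) ∘L ((projL Yf i) ∘L M ∘L (singleL Yf j)) ∘L (projL Yf j) else 0 := by
    simp [diagOf]
  rw [adjoint_upperOf, hM', hdiag, upperOf]
  conv_rhs => rw [hsum]
  simp only [← Finset.sum_add_distrib]
  refine Finset.sum_congr rfl fun i _ => Finset.sum_congr rfl fun j _ => ?_
  rcases lt_trichotomy i j with h | h | h
  · simp [h, h.ne, h.not_gt]
  · simp [h]
  · simp [h, h.ne', h.not_gt]

theorem projL_diagOf (M : PiLp 2 Yf →L[ℝ] PiLp 2 Yf) (i : Fin n) (v : PiLp 2 Yf) :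
    projL Yf i (diagOf Yf M v) = projL Yf i (M (singleL Yf i (projL Yf i v))) := by
  rw [diagOf_apply, map_sum, Finset.sum_eq_single i, projL_singleL_self]
  · exact fun j _ hj => projL_singleL_of_ne hj.symm _
  · simp

theorem projL_adjoint_upperOf_eq_zero (M : PiLp 2 Yf →L[ℝ] PiLp 2 Yf) (i : Fin n)
    (v : PiLp 2 Yf) (hv : ∀ j < i, projL Yf j v = 0) :
    projL Yf i (adjoint (upperOf Yf M) v) = 0 := by
  rw [adjoint_upperOf]
  simp only [_root_.sum_apply, map_sum]
  refine Finset.sum_eq_zero fun k _ => Finset.sum_eq_zero fun j _ => ?_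
  split_ifs with hjk
  · rcases eq_or_ne i k with rfl | hik
    · simp [hv j hjk]
    · exact projL_singleL_of_ne hik _
  · simp

theorem inner_diagOf_self (M : PiLp 2 Yf →L[ℝ] PiLp 2 Yf) (v : PiLp 2 Yf) :
    ⟪diagOf Yf M v, v⟫
      = ∑ i, ⟪projL Yf i (M (singleL Yf i (projL Yf i v))), projL Yf i v⟫ := by
  simp only [diagOf_apply, sum_inner, inner_singleL_left]

theorem inner_diagOf_self_pos {M : PiLp 2 Yf →L[ℝ] PiLp 2 Yf}
    (hM : ∀ (i : Fin n) (t : Yf i), t ≠ 0 → 0 < ⟪projL Yf i (M (singleL Yf i t)), t⟫)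
    {v : PiLp 2 Yf} (hv : v ≠ 0) : 0 < ⟪diagOf Yf M v, v⟫ := by
  rw [inner_diagOf_self]
  obtain ⟨k, hk⟩ : ∃ k, projL Yf k v ≠ 0 := by
    by_contra! h
    exact hv (by ext k; exact h k)
  refine Finset.sum_pos' (fun i _ => ?_) ⟨k, Finset.mem_univ k, hM k _ hk⟩
  rcases eq_or_ne (projL Yf i v) 0 with h | h
  · simp [h]
  · exact (hM i _ h).le

theorem eq_zero_of_diagOf_add_adjoint_upperOf {M : PiLp 2 Yf →L[ℝ] PiLp 2 Yf}
    (hM : ∀ (i : Fin n) (t : Yf i), t ≠ 0 → 0 < ⟪projL Yf i (M (singleL Yf i t)), t⟫)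
    {v : PiLp 2 Yf} (hv : (diagOf Yf M + adjoint (upperOf Yf M)) v = 0) : v = 0 := by
  have key : ∀ i, projL Yf i v = 0 := by
    intro i
    induction i using WellFoundedLT.induction with
    | ind i ih =>
      have h := congrArg (projL Yf i) hv
      rw [_root_.add_apply, map_add, projL_diagOf,
        projL_adjoint_upperOf_eq_zero M i v ih, add_zero, map_zero] at h
      by_contra hne
      have := hM i _ hne
      rw [h, inner_zero_left] at this
      exact this.false
  ext i
  exact key i

end BlockOperators

/-- Let `N` be a self-adjoint operator on `Y = Y₁ × ⋯ × Y_s` with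
block-diagonal part `N_d` and strict block upper-triangular part `N_u`, so that
`N = N_d + N_u + N_u*`.  If each diagonal block `N_{ii}` is self-adjoint positive
definite, then `N + N_u N_d⁻¹ N_u* = (N_d + N_u) N_d⁻¹ (N_d + N_u*)`, and this operator
is self-adjoint positive definite on `Y`. -/
theorem stmt_12 {n : ℕ}
    (Yf : Fin n → Type*) [∀ i, NormedAddCommGroup (Yf i)]
    [∀ i, InnerProductSpace ℝ (Yf i)] [∀ i, FiniteDimensional ℝ (Yf i)]
    (N : PiLp 2 Yf →L[ℝ] PiLp 2 Yf) (hNsa : IsSelfAdjoint N)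
    -- each diagonal block `N_{ii}` is self-adjoint positive definite
    (hdiagsa : ∀ i : Fin n, IsSelfAdjoint ((projL Yf i) ∘L N ∘L (singleL Yf i)))
    (hdiagpos : ∀ (i : Fin n) (t : Yf i), t ≠ 0 →
      0 < ⟪projL Yf i (N (singleL Yf i t)), t⟫)
    -- `Ndinv` is the inverse `N_d⁻¹` of the block-diagonal part `N_d`
    (Ndinv : PiLp 2 Yf →L[ℝ] PiLp 2 Yf)
    (hNdinv1 : Ndinv ∘L diagOf Yf N = ContinuousLinearMap.id ℝ (PiLp 2 Yf))
    (hNdinv2 : diagOf Yf N ∘L Ndinv = ContinuousLinearMap.id ℝ (PiLp 2 Yf)) :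
    N + upperOf Yf N ∘L Ndinv ∘L ContinuousLinearMap.adjoint (upperOf Yf N)
      = (diagOf Yf N + upperOf Yf N) ∘L Ndinv ∘L
        (diagOf Yf N + ContinuousLinearMap.adjoint (upperOf Yf N)) ∧
    IsSelfAdjoint
      (N + upperOf Yf N ∘L Ndinv ∘L ContinuousLinearMap.adjoint (upperOf Yf N)) ∧
    ∀ v : PiLp 2 Yf, v ≠ 0 →
      0 < ⟪(N + upperOf Yf N ∘L Ndinv ∘L ContinuousLinearMap.adjoint (upperOf Yf N)) v,
        v⟫ := by
  have hN : diagOf Yf N + upperOf Yf N + adjoint (upperOf Yf N) = N :=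
    diagOf_add_upperOf_add_adjoint hNsa
  have hD : adjoint (diagOf Yf N) = diagOf Yf N := by
    rw [adjoint_diagOf, show adjoint N = N from hNsa]
  have hpos : ∀ w, w ≠ 0 → 0 < ⟪diagOf Yf N w, w⟫ :=
    fun w hw => inner_diagOf_self_pos hdiagpos hw
  have hinj : ∀ v, (diagOf Yf N + adjoint (upperOf Yf N)) v = 0 → v = 0 :=
    fun v hv => eq_zero_of_diagOf_add_adjoint_upperOf hdiagpos hv
  clear hdiagsa hdiagpos
  generalize diagOf Yf N = D at *
  generalize upperOf Yf N = U at *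
  have h1 : ∀ v, Ndinv (D v) = v := fun v => DFunLike.congr_fun hNdinv1 v
  have h2 : ∀ v, D (Ndinv v) = v := fun v => DFunLike.congr_fun hNdinv2 v
  have hfact : N + U ∘L Ndinv ∘L adjoint U
      = (D + U) ∘L Ndinv ∘L (D + adjoint U) := by
    ext1 v
    rw [← hN]
    simp only [_root_.add_apply, ContinuousLinearMap.comp_apply, map_add, h1, h2]
    abel
  have hinv : adjoint Ndinv = Ndinv := by
    symm
    rw [eq_adjoint_iff]
    intro x y
    conv_lhs => rw [← h2 y]
    rw [← adjoint_inner_left, hD, h2]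
  refine ⟨hfact, ?_, fun v hv => ?_⟩
  · change adjoint _ = _
    rw [hfact]
    simp only [adjoint_comp, map_add, adjoint_adjoint, hD, hinv, ContinuousLinearMap.comp_assoc]
  · have hw : Ndinv ((D + adjoint U) v) ≠ 0 := by
      intro h
      apply hv
      apply hinj
      rw [← h2 ((D + adjoint U) v), h, map_zero]
    have hadj : D + U = adjoint (D + adjoint U) := by
      rw [map_add, adjoint_adjoint, hD]
    rw [hfact, ContinuousLinearMap.comp_apply, ContinuousLinearMap.comp_apply, hadj,
      adjoint_inner_left, real_inner_comm]
    have := hpos _ hw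
    rwa [h2] at this
end
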